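/- arXiv:1812.02574 — 5 statements merged into one kernel-verified Lean document; each statement's English description precedes it below -/
import Mathlib

section
/- For every complex number z with 0 < |z| < π, the function z·cot(z) has the convergent series expansion z·cot(z) = 1 + ∑_{n=1}^∞ (−4)^n B_{2n} z^{2n} / (2n)!. -/
open scoped Real Nat

lemma Complex.mem_integerComplement_of_norm_lt_one {x : ℂ} (hx : x ≠ 0) (hx' : ‖x‖ < 1) :
    x ∈ Complex.integerComplement := by
  rintro ⟨n, rfl⟩
  rw [Complex.norm_intCast] at hx'
  have h : |n| < 1 := by exact_mod_cast hx'
  exact hx (by simpa using Int.abs_lt_one_iff.mp h)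

lemma summable_div_nat_succ_pow_two_mul {x : ℂ} (hx : ‖x‖ < 1) :
    Summable fun p : ℕ × ℕ => (x / (p.1 + 1)) ^ (2 * (p.2 + 1)) := by
  have hj : Summable fun j : ℕ => 1 / ((j : ℝ) + 1) ^ 2 := by
    simpa using (summable_nat_add_iff 1).mpr (Real.summable_one_div_nat_pow.mpr one_lt_two)
  have hk : Summable fun k : ℕ => (‖x‖ ^ 2) ^ k :=
    summable_geometric_of_lt_one (by positivity) (pow_lt_one₀ (norm_nonneg x) hx two_ne_zero)
  refine Summable.of_norm_bounded (hj.mul_of_nonneg hk (fun _ => by positivity)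
    fun _ => by positivity) fun ⟨j, k⟩ => ?_
  have hn : ‖(j : ℂ) + 1‖ = (j : ℝ) + 1 := by exact_mod_cast Complex.norm_natCast (j + 1)
  have h1 : ‖x‖ / ((j : ℝ) + 1) ≤ ‖x‖ := div_le_self (norm_nonneg x) (by simp)
  have h2 : ‖x‖ / ((j : ℝ) + 1) ≤ 1 / ((j : ℝ) + 1) := by gcongr
  calc ‖(x / ((j : ℂ) + 1)) ^ (2 * (k + 1))‖
      = (‖x‖ / ((j : ℝ) + 1)) ^ 2 * ((‖x‖ / ((j : ℝ) + 1)) ^ 2) ^ k := by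
        rw [norm_pow, norm_div, hn]; ring
    _ ≤ (1 / ((j : ℝ) + 1)) ^ 2 * (‖x‖ ^ 2) ^ k := by gcongr
    _ = 1 / ((j : ℝ) + 1) ^ 2 * (‖x‖ ^ 2) ^ k := by rw [one_div_pow]

lemma hasSum_pow_two_mul_succ {w : ℂ} (hw : ‖w‖ < 1) :
    HasSum (fun k : ℕ => w ^ (2 * (k + 1))) (w ^ 2 / (1 - w ^ 2)) := by
  have h : ‖w ^ 2‖ < 1 := by
    rw [norm_pow]; exact pow_lt_one₀ (norm_nonneg w) hw two_ne_zero
  simpa only [pow_mul, pow_succ' (w ^ 2), div_eq_mul_inv] using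
    (hasSum_geometric_of_norm_lt_one h).mul_left (w ^ 2)

lemma hasSum_div_nat_succ_pow_two_mul (x : ℂ) {k : ℕ} (hk : k ≠ 0) :
    HasSum (fun j : ℕ => (x / (j + 1)) ^ (2 * k))
      (x ^ (2 * k) * ((-1) ^ (k + 1) * 2 ^ (2 * k - 1) * π ^ (2 * k) *
        bernoulli (2 * k) / (2 * k)!)) := by
  have h := (hasSum_nat_add_iff' 1).mpr (hasSum_zeta_nat hk)
  have h' := (Complex.hasSum_ofReal.mpr h).mul_left (x ^ (2 * k))
  simpa [hk, div_eq_mul_inv, mul_pow] using h'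

theorem hasSum_pi_mul_cot {x : ℂ} (hx : x ≠ 0) (hx' : ‖x‖ < 1) :
    HasSum (fun j : ℕ => -2 * ((x / (j + 1)) ^ 2 / (1 - (x / (j + 1)) ^ 2)))
      (π * x * Complex.cot (π * x) - 1) := by
  have hxZ := Complex.mem_integerComplement_of_norm_lt_one hx hx'
  have h := ((summable_cotTerm hxZ).hasSum_iff_tendsto_nat.mpr
    (tendsto_logDeriv_euler_cot_sub hxZ)).mul_left x
  convert! h using 1
  · ext j
    have hj : (j : ℂ) + 1 ≠ 0 := Nat.cast_add_one_ne_zero j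
    have hadd : x + (j + 1) ≠ 0 := by
      simpa using Complex.integerComplement_add_ne_zero hxZ ((j : ℤ) + 1)
    have hsub : x - (j + 1) ≠ 0 := by
      simpa [sub_eq_add_neg] using Complex.integerComplement_add_ne_zero hxZ (-(j + 1) : ℤ)
    have hsq : ((j : ℂ) + 1) ^ 2 - x ^ 2 ≠ 0 := by
      rw [show ((j : ℂ) + 1) ^ 2 - x ^ 2 = -((x + (j + 1)) * (x - (j + 1))) by ring]
      exact neg_ne_zero.mpr (mul_ne_zero hadd hsub)
    have hden : 1 - (x / ((j : ℂ) + 1)) ^ 2 = (((j : ℂ) + 1) ^ 2 - x ^ 2) / (j + 1) ^ 2 := by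
      field_simp
    rw [cotTerm_identity hxZ, hden]
    field_simp
    ring
  · field_simp

/-- For `0 < |z| < π`, `z·cot z = 1 + ∑_{n=1}^∞ (-4)^n B_{2n} z^(2n) / (2n)!`,
the series being convergent. -/
theorem z_cot_z_bernoulli (z : ℂ) (hz : 0 < ‖z‖) (hz' : ‖z‖ < π) :
    HasSum (fun n : ℕ =>
        (-4 : ℂ) ^ (n + 1) * (bernoulli (2 * (n + 1)) : ℂ) * z ^ (2 * (n + 1)) /
          ((2 * (n + 1))! : ℂ))
      (z * Complex.cot z - 1) := by
  have hπ : (π : ℂ) ≠ 0 := by exact_mod_cast Real.pi_ne_zero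
  obtain ⟨x, rfl⟩ : ∃ x : ℂ, z = π * x := ⟨z / π, by field_simp⟩
  have hx : x ≠ 0 := right_ne_zero_of_mul (norm_pos_iff.mp hz)
  have hx' : ‖x‖ < 1 := by
    rw [norm_mul, Complex.norm_real, Real.norm_of_nonneg Real.pi_pos.le] at hz'
    exact (mul_lt_iff_lt_one_right Real.pi_pos).mp hz'
  have hdouble := ((summable_div_nat_succ_pow_two_mul hx').mul_left (-2)).hasSum
  have hrow (j : ℕ) : HasSum (fun k : ℕ => -2 * (x / (j + 1)) ^ (2 * (k + 1)))
      (-2 * ((x / (j + 1)) ^ 2 / (1 - (x / (j + 1)) ^ 2))) := by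
    refine (hasSum_pow_two_mul_succ (lt_of_le_of_lt ?_ hx')).mul_left (-2)
    have hn : ‖(j : ℂ) + 1‖ = (j : ℝ) + 1 := by exact_mod_cast Complex.norm_natCast (j + 1)
    rw [norm_div, hn]
    exact div_le_self (norm_nonneg x) (by simp)
  have hcol (k : ℕ) :=
    (hasSum_div_nat_succ_pow_two_mul x k.add_one_ne_zero).mul_left (-2)
  rw [(hasSum_pi_mul_cot hx hx').unique (hdouble.prod_fiberwise hrow)]
  convert! ((Equiv.prodComm ℕ ℕ).hasSum_iff.mpr hdouble).prod_fiberwise hcol using 2 with k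
  rw [show 2 * (k + 1) - 1 = 2 * k + 1 by omega,
    show (-4 : ℂ) = -1 * 2 ^ 2 by norm_num, mul_pow, ← pow_mul]
  ring
end

section
/- Let n be a positive integer and let z be a complex number such that z/π is not an integer. Then cot(z) = (1/2^n) · ∑_{j=0}^{2^n − 1} cot((z + jπ)/2^n). -/
open scoped Real

/-- The cotangent bisection formula; it also holds at the poles, where both sides are zero by the
convention `x / 0 = 0`. -/
theorem Complex.cot_eq_half_mul_cot_half_add (w : ℂ) :
    Complex.cot w = 1 / 2 * (Complex.cot (w / 2) + Complex.cot ((w + π) / 2)) := by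
  obtain ⟨u, rfl⟩ : ∃ u, w = 2 * u := ⟨w / 2, by ring⟩
  rw [show 2 * u / 2 = u by ring, show (2 * u + π) / 2 = u + π / 2 by ring]
  simp only [Complex.cot, Complex.sin_add_pi_div_two, Complex.cos_add_pi_div_two,
    Complex.sin_two_mul, Complex.cos_two_mul']
  by_cases hs : Complex.sin u = 0
  · simp [hs]
  by_cases hc : Complex.cos u = 0
  · simp [hc]
  field_simp
  ring

/-- The iterated cotangent bisection formula, valid at every `z` under `x / 0 = 0`. -/
theorem Complex.cot_eq_sum_cot_add_mul_pi_div_two_pow (n : ℕ) (z : ℂ) :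
    Complex.cot z =
      (1 / 2 ^ n) * ∑ j ∈ Finset.range (2 ^ n), Complex.cot ((z + j * π) / 2 ^ n) := by
  induction n with
  | zero => simp
  | succ n ih =>
    rw [ih, pow_succ (2 : ℂ), pow_succ (2 : ℕ), mul_two (2 ^ n : ℕ), Finset.sum_range_add, ← Finset.sum_add_distrib,
      Finset.mul_sum, Finset.mul_sum]
    refine Finset.sum_congr rfl fun j _ => ?_
    rw [Complex.cot_eq_half_mul_cot_half_add,
      show (z + j * π) / 2 ^ n / 2 = (z + j * π) / (2 ^ n * 2) by field_simp,
      show ((z + j * π) / 2 ^ n + π) / 2 = (z + (2 ^ n + j : ℕ) * π) / (2 ^ n * 2) by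
        push_cast
        field_simp
        ring]
    field_simp

/-- Cotangent bisection identity iterated `n` times:
`cot z = 2⁻ⁿ ∑_{j=0}^{2ⁿ-1} cot((z + jπ)/2ⁿ)`. -/
theorem cot_sum_identity (n : ℕ) (hn : 0 < n) (z : ℂ)
    (hz : ∀ m : ℤ, z / π ≠ (m : ℂ)) :
    Complex.cot z =
      (1 / 2 ^ n) * ∑ j ∈ Finset.range (2 ^ n), Complex.cot ((z + j * π) / 2 ^ n) := by
  exact Complex.cot_eq_sum_cot_add_mul_pi_div_two_pow n z
end

section
/- Let n be a positive integer and let z be a complex number such that z/π is not an integer. Then cot(z) = cot(z/2^n)/2^n − tan(z/2^n)/2^n + (1/2^n) · ∑_{j=1}^{2^{n−1} − 1} [ cot((z + jπ)/2^n) + cot((z − jπ)/2^n) ]. -/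
open scoped Real

theorem Complex.cot_add_pi_div_two (w : ℂ) : cot (w + π / 2) = -tan w := by
  rw [cot, tan, cos_add_pi_div_two, sin_add_pi_div_two, neg_div]

theorem Complex.cot_add_pi (w : ℂ) : cot (w + π) = cot w := by
  rw [cot, cot, cos_add_pi, sin_add_pi, neg_div_neg_eq]

/-- The duplication formula; at the poles both sides are zero by the convention `x / 0 = 0`. -/
theorem Complex.cot_two_mul_eq (w : ℂ) : 2 * cot (2 * w) = cot w - tan w := by
  rw [cot, cot, tan, sin_two_mul, cos_two_mul']
  rcases eq_or_ne (sin w) 0 with hs | hs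
  · simp [hs]
  rcases eq_or_ne (cos w) 0 with hc | hc
  · simp [hc]
  field_simp

theorem Complex.two_pow_mul_cot_eq_sum (n : ℕ) (z : ℂ) :
    2 ^ n * cot z = ∑ j ∈ Finset.range (2 ^ n), cot ((z + j * π) / 2 ^ n) := by
  induction n with
  | zero => simp
  | succ n ih =>
    rw [pow_succ', mul_assoc, ih, Finset.mul_sum, pow_succ' 2 n, two_mul (2 ^ n : ℕ),
      Finset.sum_range_add, ← Finset.sum_add_distrib]
    refine Finset.sum_congr rfl fun j _ => ?_
    have h_double : (z + j * π) / 2 ^ n = 2 * ((z + j * π) / (2 * 2 ^ n)) := by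
      field_simp
    have h_shift : (z + ((2 ^ n + j : ℕ) : ℂ) * π) / (2 * 2 ^ n) =
        (z + j * π) / (2 * 2 ^ n) + π / 2 := by
      push_cast
      field_simp
      ring
    rw [h_double, h_shift, cot_add_pi_div_two, cot_two_mul_eq, sub_eq_add_neg]

theorem Complex.sum_cot_range_two_mul (m : ℕ) (z : ℂ) :
    ∑ j ∈ Finset.range (2 * (m + 1)), cot ((z + j * π) / (2 * (m + 1))) =
      cot (z / (2 * (m + 1))) - tan (z / (2 * (m + 1))) +
        ∑ j ∈ Finset.Icc 1 m,
          (cot ((z + j * π) / (2 * (m + 1))) + cot ((z - j * π) / (2 * (m + 1)))) := by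
  have hm : (m : ℂ) + 1 ≠ 0 := Nat.cast_add_one_ne_zero m
  have h_mid : cot ((z + ((m + 1 + 0 : ℕ) : ℂ) * π) / (2 * (m + 1))) =
      -tan (z / (2 * (m + 1))) := by
    rw [← cot_add_pi_div_two]
    congr 1
    push_cast
    field_simp
    ring
  have h_upper : ∑ j ∈ Finset.range m,
      cot ((z + ((m + 1 + (j + 1) : ℕ) : ℂ) * π) / (2 * (m + 1))) =
      ∑ j ∈ Finset.range m, cot ((z - ((j + 1 : ℕ) : ℂ) * π) / (2 * (m + 1))) := by
    rw [← Finset.sum_range_reflect]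
    refine Finset.sum_congr rfl fun j hj => ?_
    have h_index : m + 1 + (m - 1 - j + 1) + (j + 1) = 2 * (m + 1) := by
      have := Finset.mem_range.mp hj
      omega
    have h_cast := congrArg (Nat.cast : ℕ → ℂ) h_index
    rw [Nat.cast_add, ← eq_sub_iff_add_eq] at h_cast
    rw [h_cast, ← cot_add_pi ((z - _) / _)]
    congr 1
    push_cast
    field_simp
    ring
  have h_Icc (f : ℕ → ℂ) : ∑ j ∈ Finset.Icc 1 m, f j = ∑ j ∈ Finset.range m, f (j + 1) := by
    rw [Finset.range_eq_Ico, Finset.sum_Ico_add' f 0 m 1]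
    rfl
  rw [two_mul (m + 1), Finset.sum_range_add, Finset.sum_range_succ', Finset.sum_range_succ',
    h_mid, h_upper, h_Icc, Finset.sum_add_distrib]
  simp only [Nat.cast_zero, zero_mul, add_zero]
  ring

/-- `cot z = cot(z/2ⁿ)/2ⁿ − tan(z/2ⁿ)/2ⁿ
      + 2⁻ⁿ ∑_{j=1}^{2^{n-1}-1} (cot((z+jπ)/2ⁿ) + cot((z−jπ)/2ⁿ))`. -/
theorem cot_sum_identity' (n : ℕ) (hn : 0 < n) (z : ℂ)
    (hz : ∀ m : ℤ, z / π ≠ (m : ℂ)) :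
    Complex.cot z =
      Complex.cot (z / 2 ^ n) / 2 ^ n - Complex.tan (z / 2 ^ n) / 2 ^ n +
        (1 / 2 ^ n) * ∑ j ∈ (Finset.Icc 1 (2 ^ (n - 1) - 1) : Finset ℕ),
          (Complex.cot ((z + j * π) / 2 ^ n) + Complex.cot ((z - j * π) / 2 ^ n)) := by
  obtain ⟨k, rfl⟩ : ∃ k, n = k + 1 := ⟨n - 1, by omega⟩
  have h_pow : 2 ^ k - 1 + 1 = 2 ^ k := Nat.sub_add_cancel Nat.one_le_two_pow
  have h_cast : 2 * (((2 ^ k - 1 : ℕ) : ℂ) + 1) = 2 ^ (k + 1) := by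
    rw [pow_succ']
    exact_mod_cast congrArg (2 * ·) h_pow
  have h_fold := Complex.sum_cot_range_two_mul (2 ^ k - 1) z
  rw [h_cast, h_pow, ← pow_succ', ← Complex.two_pow_mul_cot_eq_sum] at h_fold
  rw [Nat.add_sub_cancel, ← sub_div, one_div_mul_eq_div, ← add_div, ← h_fold]
  exact (mul_div_cancel_left₀ _ (pow_ne_zero _ two_ne_zero)).symm
end

section
/- For every complex number z with z/π not an integer, z·cot(z) = 1 − 2 · ∑_{j=1}^∞ z² / (j²π² − z²), where the series on the right converges. -/
open scoped Real

/-- Partial fraction expansion of the cotangent: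
`z·cot z = 1 − 2 ∑_{j=1}^∞ z² / (j²π² − z²)`, the series being convergent. -/
theorem z_cot_z_partial_fractions (z : ℂ) (hz : ∀ m : ℤ, z / π ≠ (m : ℂ)) :
    HasSum (fun j : ℕ => z ^ 2 / (((j : ℂ) + 1) ^ 2 * (π : ℂ) ^ 2 - z ^ 2))
      ((1 - z * Complex.cot z) / 2) := by
  have hpi : (π : ℂ) ≠ 0 := Complex.ofReal_ne_zero.mpr Real.pi_ne_zero
  obtain ⟨x, rfl⟩ : ∃ x, z = π * x := ⟨z / π, (mul_div_cancel₀ z hpi).symm⟩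
  simp only [mul_div_cancel_left₀ x hpi] at hz
  have hx : x ∈ Complex.integerComplement := fun ⟨m, hm⟩ => hz m hm.symm
  have hx0 : x ≠ 0 := Complex.integerComplement.ne_zero hx
  have h := (summable_cotTerm hx).hasSum
  rw [← cot_series_rep' hx] at h
  have hval : (1 - π * x * Complex.cot (π * x)) / 2 =
      -x / 2 * (π * Complex.cot (π * x) - 1 / x) := by
    field_simp
    ring
  rw [hval]
  refine (h.mul_left (-x / 2)).congr_fun fun j => ?_
  have h1 : x + ((j : ℂ) + 1) ≠ 0 := by
    simpa using Complex.integerComplement_add_ne_zero hx ((j : ℤ) + 1)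
  have h2 : x - ((j : ℂ) + 1) ≠ 0 := sub_ne_zero.mpr (by simpa using hz ((j : ℤ) + 1))
  have h3 : ((j : ℂ) + 1) ^ 2 * (π : ℂ) ^ 2 - (π * x) ^ 2 ≠ 0 := by
    rw [show ((j : ℂ) + 1) ^ 2 * (π : ℂ) ^ 2 - (π * x) ^ 2 =
      -(π ^ 2 * ((x + (j + 1)) * (x - (j + 1)))) by ring]
    exact neg_ne_zero.mpr (mul_ne_zero (pow_ne_zero 2 hpi) (mul_ne_zero h1 h2))
  rw [cotTerm, one_div_add_one_div h2 h1, div_mul_div_comm, div_eq_div_iff h3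
    (mul_ne_zero two_ne_zero (mul_ne_zero h2 h1))]
  ring
end

section
/- For every complex number s, 1/Γ(s) = s · e^{γs} · ∏_{n=1}^∞ (1 + s/n) · e^{−s/n}, where γ is the Euler–Mascheroni constant and the infinite product converges. -/
open Filter Topology

/-- The primary factor `(1 + z) e^{-z}` is within `3 ‖z‖ ^ 2` of `1` on the unit disc. -/
lemma norm_one_add_mul_exp_neg_sub_one_le {z : ℂ} (hz : ‖z‖ ≤ 1) :
    ‖(1 + z) * Complex.exp (-z) - 1‖ ≤ 3 * ‖z‖ ^ 2 := by
  have h := Complex.norm_exp_sub_one_sub_id_le (x := -z) (by simpa using hz)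
  rw [norm_neg] at h
  have h1 : ‖1 + z‖ ≤ 2 := (norm_add_le _ _).trans (by rw [norm_one]; linarith)
  calc ‖(1 + z) * Complex.exp (-z) - 1‖
      = ‖(1 + z) * (Complex.exp (-z) - 1 - -z) - z ^ 2‖ := by ring_nf
    _ ≤ ‖1 + z‖ * ‖Complex.exp (-z) - 1 - -z‖ + ‖z‖ ^ 2 := by
        rw [← norm_mul, ← norm_pow]
        exact norm_sub_le _ _
    _ ≤ 2 * ‖z‖ ^ 2 + ‖z‖ ^ 2 := by gcongr
    _ = 3 * ‖z‖ ^ 2 := by ring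

lemma multipliable_one_add_div_mul_exp_neg (s : ℂ) :
    Multipliable (fun n : ℕ =>
      (1 + s / ((n : ℂ) + 1)) * Complex.exp (-s / ((n : ℂ) + 1))) := by
  have hnorm (n : ℕ) : ‖s / ((n : ℂ) + 1)‖ = ‖s‖ / ((n : ℝ) + 1) := by
    rw [norm_div]
    congr 1
    exact_mod_cast Complex.norm_natCast (n + 1)
  have hsum : Summable fun n : ℕ => 3 * (‖s‖ / ((n : ℝ) + 1)) ^ 2 := by
    have h := (summable_nat_add_iff 1).2 (Real.summable_one_div_nat_pow.2 one_lt_two)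
    refine (h.mul_left (3 * ‖s‖ ^ 2)).congr fun n => ?_
    push_cast
    field_simp
  have hf : Summable fun n : ℕ =>
      ‖(1 + s / ((n : ℂ) + 1)) * Complex.exp (-s / ((n : ℂ) + 1)) - 1‖ := by
    refine hsum.of_norm_bounded_eventually_nat ?_
    filter_upwards [eventually_ge_atTop ⌈‖s‖⌉₊] with n hn
    rw [norm_norm, ← hnorm, neg_div]
    refine norm_one_add_mul_exp_neg_sub_one_le ?_
    rw [hnorm, div_le_one (by positivity)]
    linarith [Nat.ceil_le.1 hn]
  simpa using multipliable_one_add_of_summable hf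

/-- Euler's sequence for `1 / Γ(s)` in terms of the partial Weierstrass products. -/
lemma inv_GammaSeq_eq_prod (s : ℂ) {n : ℕ} (hn : n ≠ 0) :
    (Complex.GammaSeq s n)⁻¹ =
      s * Complex.exp (((harmonic n - Real.log n : ℝ) : ℂ) * s) *
        ∏ k ∈ Finset.range n,
          (1 + s / ((k : ℂ) + 1)) * Complex.exp (-s / ((k : ℂ) + 1)) := by
  have hexp : ∏ k ∈ Finset.range n, Complex.exp (-s / ((k : ℂ) + 1)) =
      Complex.exp (-(harmonic n : ℂ) * s) := by
    rw [← Complex.exp_sum, harmonic]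
    push_cast
    rw [neg_mul, Finset.sum_mul, ← Finset.sum_neg_distrib]
    congr 1
    refine Finset.sum_congr rfl fun k _ => ?_
    ring
  have hprod : ∏ k ∈ Finset.range n, (1 + s / ((k : ℂ) + 1)) =
      (∏ k ∈ Finset.range n, (s + ((k + 1 : ℕ) : ℂ))) / (n.factorial : ℂ) := by
    rw [← Finset.prod_range_add_one_eq_factorial, Nat.cast_prod, ← Finset.prod_div_distrib]
    refine Finset.prod_congr rfl fun k _ => ?_
    have : (k : ℂ) + 1 ≠ 0 := Nat.cast_add_one_ne_zero k
    push_cast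
    field_simp
    ring
  have hcancel : Complex.exp (((harmonic n - Real.log n : ℝ) : ℂ) * s) *
      Complex.exp (-(harmonic n : ℂ) * s) = ((n : ℂ) ^ s)⁻¹ := by
    rw [Complex.cpow_def_of_ne_zero (Nat.cast_ne_zero.2 hn), ← Complex.exp_add, ← Complex.exp_neg]
    push_cast
    ring_nf
  rw [Finset.prod_mul_distrib, hexp, hprod, Complex.GammaSeq, Finset.prod_range_succ',
    Nat.cast_zero, add_zero, inv_div, div_eq_mul_inv, mul_inv, ← hcancel]
  ring

lemma tendsto_inv_GammaSeq (s : ℂ) :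
    Tendsto (fun n => (Complex.GammaSeq s n)⁻¹) atTop (𝓝 (Complex.Gamma s)⁻¹) := by
  by_cases h : Complex.Gamma s = 0
  · obtain ⟨m, rfl⟩ := (Complex.Gamma_eq_zero_iff s).1 h
    rw [h]
    refine tendsto_const_nhds.congr' ?_
    filter_upwards [eventually_ge_atTop m] with n hn
    rw [Complex.GammaSeq, Finset.prod_eq_zero (Finset.mem_range.2 (Nat.lt_succ_of_le hn))
      (neg_add_cancel _), div_zero]
  · exact (Complex.GammaSeq_tendsto_Gamma s).inv₀ h

/-- Weierstrass product for the reciprocal Gamma function: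
`1/Γ(s) = s e^{γs} ∏_{n=1}^∞ (1 + s/n) e^{-s/n}`, the product being convergent. -/
theorem one_div_Gamma_weierstrass (s : ℂ) :
    Multipliable (fun n : ℕ =>
        (1 + s / ((n : ℂ) + 1)) * Complex.exp (-s / ((n : ℂ) + 1))) ∧
      (Complex.Gamma s)⁻¹ =
        s * Complex.exp ((Real.eulerMascheroniConstant : ℂ) * s) *
          ∏' n : ℕ, (1 + s / ((n : ℂ) + 1)) * Complex.exp (-s / ((n : ℂ) + 1)) := by
  have hm := multipliable_one_add_div_mul_exp_neg s
  refine ⟨hm, tendsto_nhds_unique (tendsto_inv_GammaSeq s) ?_⟩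
  have hγ : Tendsto (fun n : ℕ => Complex.exp (((harmonic n - Real.log n : ℝ) : ℂ) * s)) atTop
      (𝓝 (Complex.exp ((Real.eulerMascheroniConstant : ℂ) * s))) :=
    (((Complex.continuous_ofReal.tendsto _).comp Real.tendsto_harmonic_sub_log).mul_const s).cexp
  refine ((hγ.const_mul s).mul hm.hasProd.tendsto_prod_nat).congr' ?_
  filter_upwards [eventually_ne_atTop 0] with n hn using (inv_GammaSeq_eq_prod s hn).symm
end
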